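/- Let (u,R) and (v,S) be admissible pairs such that (u,R) ≤ (v,S) in the combinatorial order and L(u,R) ≥ L(v,S). Then (u,R) = (v,S). -/

import Mathlib

open scoped RealInnerProductSpace
open Classical

noncomputable section

variable (V : Type) [NormedAddCommGroup V] [InnerProductSpace ℝ V]

/-- The reflection determined by a vector `α` (the identity map if `α = 0`),
as a linear endomorphism:  `x ↦ x - (2⟪x,α⟫/⟪α,α⟫) • α`. -/
def reflMap (α : V) : V →ₗ[ℝ] V where
  toFun x := x - (2 * ⟪x, α⟫ / ⟪α, α⟫) • α
  map_add' x y := by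
    simp only [inner_add_left]
    rw [show 2 * (⟪x, α⟫ + ⟪y, α⟫) / ⟪α, α⟫
        = 2 * ⟪x, α⟫ / ⟪α, α⟫ + 2 * ⟪y, α⟫ / ⟪α, α⟫ by ring, add_smul]
    abel
  map_smul' c x := by
    simp only [real_inner_smul_left, RingHom.id_apply, smul_sub]
    rw [show 2 * (c * ⟪x, α⟫) / ⟪α, α⟫ = c * (2 * ⟪x, α⟫ / ⟪α, α⟫) by ring,
      mul_smul]

lemma reflMap_apply (α x : V) :
    reflMap V α x = x - (2 * ⟪x, α⟫ / ⟪α, α⟫) • α := rfl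

lemma reflMap_involutive (α : V) : ∀ x, reflMap V α (reflMap V α x) = x := by
  intro x
  by_cases h : (⟪α, α⟫ : ℝ) = 0
  · have h0 : α = 0 := inner_self_eq_zero.mp h
    simp [reflMap_apply, h0]
  · rw [reflMap_apply, reflMap_apply, inner_sub_left, real_inner_smul_left,
      div_mul_cancel₀ _ h]
    rw [show ⟪x, α⟫ - 2 * ⟪x, α⟫ = -⟪x, α⟫ by ring]
    rw [show 2 * -⟪x, α⟫ / ⟪α, α⟫ = -(2 * ⟪x, α⟫ / ⟪α, α⟫) by ring, neg_smul]
    abel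

/-- The reflection determined by a vector `α`, as a linear automorphism of `V`. -/
def sref (α : V) : V ≃ₗ[ℝ] V :=
  { reflMap V α with
    invFun := reflMap V α
    left_inv := reflMap_involutive V α
    right_inv := reflMap_involutive V α }

lemma sref_apply (α x : V) :
    sref V α x = x - (2 * ⟪x, α⟫ / ⟪α, α⟫) • α := rfl

variable {V}

/-- The coroot `α^∨ = 2α/⟪α,α⟫` associated with a root `α`, under the identification of the
coweight space with `V` given by the inner product. -/
def coroot (α : V) : V := (2 / ⟪α, α⟫) • α

/-- The dimension of the `(-1)`-eigenspace of a linear automorphism. -/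
def lamEig (σ : V ≃ₗ[ℝ] V) : ℕ :=
  Module.finrank ℝ (Module.End.eigenspace (σ : V →ₗ[ℝ] V) (-1))

/-- The action `s_α ∘ σ` of a simple reflection on an involution: `s_α σ` if `s_α` and `σ`
commute, and `s_α σ s_α` otherwise. -/
def circAct (α : V) (σ : V ≃ₗ[ℝ] V) : V ≃ₗ[ℝ] V :=
  if sref V α * σ = σ * sref V α then sref V α * σ else sref V α * σ * sref V α

/-- A set of pairwise orthogonal vectors. -/
def OrthSet (S : Finset V) : Prop :=
  (↑S : Set V).Pairwise fun a b => ⟪a, b⟫ = 0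

/-- The product `σ_S` of the (commuting) reflections in the elements of an orthogonal set
`S`. -/
def sigmaOf (S : Finset V) : V ≃ₗ[ℝ] V :=
  (S.toList.map (sref V)).prod

variable (V)

/-- A finite crystallographic reduced root system in the Euclidean space `V`,
together with a fixed choice of simple roots. -/
structure RSD where
  /-- The set of roots. -/
  Φ : Finset V
  /-- The set of simple roots. -/
  Δ : Finset V
  nonzero : (0 : V) ∉ Φ
  span_top : Submodule.span ℝ (Φ : Set V) = ⊤
  reduced : ∀ α ∈ Φ, ∀ c : ℝ, c • α ∈ Φ → c = 1 ∨ c = -1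
  crystal : ∀ α ∈ Φ, ∀ β ∈ Φ, ∃ n : ℤ, (n : ℝ) = 2 * ⟪β, α⟫ / ⟪α, α⟫
  reflClosed : ∀ α ∈ Φ, ∀ β ∈ Φ, sref V α β ∈ Φ
  Δ_sub : Δ ⊆ Φ
  Δ_indep : LinearIndependent ℝ (fun x : (Δ : Set V) => (x : V))
  Δ_base : ∀ α ∈ Φ, (∃ c : V → ℕ, α = ∑ γ ∈ Δ, (c γ : ℝ) • γ) ∨
      (∃ c : V → ℕ, -α = ∑ γ ∈ Δ, (c γ : ℝ) • γ)

namespace RSD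

variable {V}
variable (D : RSD V)

/-- The set of positive roots. -/
def Pos : Set V :=
  {α | α ∈ D.Φ ∧ ∃ c : V → ℕ, α = ∑ γ ∈ D.Δ, (c γ : ℝ) • γ}

/-- The set of negative roots. -/
def Neg : Set V := {α | -α ∈ D.Pos}

/-- The Weyl group, as the subgroup of `GL(V)` generated by the simple reflections. -/
def W : Subgroup (V ≃ₗ[ℝ] V) := Subgroup.closure ((fun γ => sref V γ) '' ↑D.Δ)

/-- The length of `w`: the least number of simple reflections needed to write `w` as a
product of simple reflections. -/
def length (w : V ≃ₗ[ℝ] V) : ℕ :=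
  sInf {n | ∃ l : List V, l.length = n ∧ (∀ γ ∈ l, γ ∈ D.Δ) ∧ w = (l.map (sref V)).prod}

/-- The Bruhat order on the Weyl group: `u ≤ v` iff `v` is obtained from `u` by successively
multiplying by reflections, each time increasing the length. -/
def ble (u v : V ≃ₗ[ℝ] V) : Prop :=
  Relation.ReflTransGen
    (fun x y => (∃ β ∈ D.Φ, y = sref V β * x) ∧ D.length x < D.length y) u v

/-- The strict Bruhat order. -/
def blt (u v : V ≃ₗ[ℝ] V) : Prop := D.ble u v ∧ u ≠ v

/-- The dominance order: `y - x` is a nonnegative integer combination of simple roots. -/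
def dom (x y : V) : Prop := ∃ c : V → ℕ, y - x = ∑ γ ∈ D.Δ, (c γ : ℝ) • γ

/-- The dominance order on coweights: `y - x` is a nonnegative integer combination of simple
coroots. -/
def cdom (x y : V) : Prop := ∃ c : V → ℕ, y - x = ∑ γ ∈ D.Δ, (c γ : ℝ) • coroot γ

/-- The length `L(σ) = (ℓ(σ) + λ(σ))/2` of an involution `σ`, where `λ(σ)` is the dimension
of the `(-1)`-eigenspace of `σ`. -/
def Linv (σ : V ≃ₗ[ℝ] V) : ℚ :=
  ((D.length σ : ℚ) + (lamEig σ : ℚ)) / 2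

end RSD

/-- A finite irreducible crystallographic reduced root system, with a fixed choice of simple
roots and a marked simple root `αP` whose coefficient in the highest root `θ` equals `1`
(the cominuscule case). -/
structure MRSD extends RSD V where
  irred : ¬ ∃ A B : Set V, A.Nonempty ∧ B.Nonempty ∧ A ∪ B = ↑Φ ∧
      ∀ α ∈ A, ∀ β ∈ B, ⟪α, β⟫ = 0
  /-- The marked simple root. -/
  αP : V
  αP_mem : αP ∈ Δ
  /-- The highest root. -/
  θ : V
  θ_mem : θ ∈ Φ
  θ_high : ∀ α ∈ Φ, ∃ c : V → ℕ, θ - α = ∑ γ ∈ Δ, (c γ : ℝ) • γ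
  θ_coeff : ∃ c : V → ℕ, (θ = ∑ γ ∈ Δ, (c γ : ℝ) • γ) ∧ c αP = 1

namespace MRSD

variable {V}
variable (M : MRSD V)

/-- The set `Ψ` of positive roots in which the marked simple root `αP` has coefficient `1`. -/
def Psi : Set V :=
  {α | α ∈ M.Φ ∧ ∃ c : V → ℕ, (α = ∑ γ ∈ M.Δ, (c γ : ℝ) • γ) ∧ c M.αP = 1}

/-- The set of positive roots of the subsystem `Φ_P`, i.e. the positive roots in which the
marked simple root `αP` has coefficient `0`. -/
def PosP : Set V :=
  {α | α ∈ M.Φ ∧ ∃ c : V → ℕ, (α = ∑ γ ∈ M.Δ, (c γ : ℝ) • γ) ∧ c M.αP = 0}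

/-- The parabolic subgroup `W_P` generated by the simple reflections in `Δ ∖ {αP}`. -/
def WP : Subgroup (V ≃ₗ[ℝ] V) :=
  Subgroup.closure ((fun γ => sref V γ) '' ↑(M.Δ.erase M.αP))

/-- The inversion set `Φ⁺(v) = {α ∈ Φ⁺ : v(α) ∈ Φ⁻}`. -/
def InvSet (v : V ≃ₗ[ℝ] V) : Set V := {α | α ∈ M.Pos ∧ v α ∈ M.Neg}

/-- `v` belongs to `W^P`: it lies in `W` and has minimal length in its coset `v W_P`. -/
def IsMinRep (v : V ≃ₗ[ℝ] V) : Prop :=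
  v ∈ M.W ∧ ∀ u, u ∈ M.W → v⁻¹ * u ∈ M.WP → M.length v ≤ M.length u

/-- `μ` is the minimal length representative `[w]^P` of the coset `w W_P`. -/
def IsMinRepOf (μ w : V ≃ₗ[ℝ] V) : Prop :=
  (μ ∈ M.W ∧ w⁻¹ * μ ∈ M.WP) ∧
    ∀ u, u ∈ M.W → w⁻¹ * u ∈ M.WP → M.length μ ≤ M.length u

/-- The subset `Φ_S = {α ∈ Φ : σ_S(α) = -α}` determined by an orthogonal set of roots `S`. -/
def PhiSet (S : Finset V) : Set V := {α | α ∈ M.Φ ∧ sigmaOf S α = -α}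

/-- A root is long if its squared length is maximal among the roots. -/
def IsLong (α : V) : Prop := ∀ β ∈ M.Φ, ⟪β, β⟫ ≤ ⟪α, α⟫

/-- Admissible pair: `v ∈ W^P`, `S ⊆ Ψ` a set of pairwise orthogonal roots with
`v(S) ⊆ Φ⁻`. -/
def Admissible (v : V ≃ₗ[ℝ] V) (S : Finset V) : Prop :=
  M.IsMinRep v ∧ (↑S : Set V) ⊆ M.Psi ∧ OrthSet S ∧ ∀ β ∈ S, v β ∈ M.Neg

/-- The length `L(v,S) = (ℓ(σ_{v(S)}) + |S|)/2` of an admissible pair `(v,S)`. -/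
def pairL (v : V ≃ₗ[ℝ] V) (S : Finset V) : ℚ :=
  ((M.length (sigmaOf (S.image fun x => v x)) : ℚ) + (S.card : ℚ)) / 2

end MRSD

section Reflections

variable {V}

lemma sref_self (α : V) : sref V α α = -α := by
  by_cases h : α = 0
  · simp [sref_apply, h]
  · have : (⟪α, α⟫ : ℝ) ≠ 0 := inner_self_ne_zero.mpr h
    rw [sref_apply, mul_div_assoc, div_self this]
    module

lemma sref_of_inner_eq_zero {α x : V} (h : ⟪x, α⟫ = 0) : sref V α x = x := by
  simp [sref_apply, h]

lemma sref_mul_self (α : V) : sref V α * sref V α = 1 :=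
  LinearEquiv.ext (reflMap_involutive V α)

lemma sref_mul_cancel_left (α : V) (w : V ≃ₗ[ℝ] V) : sref V α * (sref V α * w) = w := by
  rw [← mul_assoc, sref_mul_self, one_mul]

lemma sref_inv (α : V) : (sref V α)⁻¹ = sref V α :=
  inv_eq_of_mul_eq_one_right (sref_mul_self α)

lemma sref_neg (α : V) : sref V (-α) = sref V α :=
  LinearEquiv.ext fun x => by simp [sref_apply, neg_div]

lemma sref_inner (α x y : V) : ⟪sref V α x, sref V α y⟫ = ⟪x, y⟫ := by
  by_cases h : α = 0
  · simp [sref_apply, h]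
  · have : (⟪α, α⟫ : ℝ) ≠ 0 := inner_self_ne_zero.mpr h
    rw [sref_apply, sref_apply]
    simp only [inner_sub_left, inner_sub_right, real_inner_smul_left, real_inner_smul_right,
      real_inner_comm α y]
    field_simp
    ring

/-- Conjugating a reflection by an isometry. -/
lemma mul_sref {w : V ≃ₗ[ℝ] V} (hw : ∀ x y, ⟪w x, w y⟫ = ⟪x, y⟫) (β : V) :
    w * sref V β = sref V (w β) * w :=
  LinearEquiv.ext fun x => by
    simp only [LinearEquiv.mul_apply, sref_apply, hw, map_sub, map_smul]

lemma prod_sref_apply (l : List V) (h : l.Pairwise fun a b => ⟪a, b⟫ = 0) (x : V) :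
    (l.map (sref V)).prod x = x - (l.map fun β => (2 * ⟪x, β⟫ / ⟪β, β⟫) • β).sum := by
  induction l with
  | nil => simp
  | cons a l ih =>
    rw [List.pairwise_cons] at h
    have hz : ⟪(l.map fun β => (2 * ⟪x, β⟫ / ⟪β, β⟫) • β).sum, a⟫ = 0 := by
      have h1 := h.1
      clear ih h
      induction l with
      | nil => simp
      | cons b l ih =>
        simp only [List.map_cons, List.sum_cons, inner_add_left, real_inner_smul_left]
        rw [ih fun c hc => h1 c (by simp [hc]), real_inner_comm a b, h1 b (by simp)]
        simp
    rw [List.map_cons, List.prod_cons, LinearEquiv.mul_apply, ih h.2, sref_apply, inner_sub_left,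
      hz, sub_zero, List.map_cons, List.sum_cons]
    abel

lemma OrthSet.subset {S T : Finset V} (h : OrthSet T) (hST : S ⊆ T) : OrthSet S :=
  Set.Pairwise.mono (by exact_mod_cast hST) h

lemma OrthSet.toList {S : Finset V} (h : OrthSet S) :
    S.toList.Pairwise fun a b => ⟪a, b⟫ = 0 := by
  refine (List.pairwise_iff_getElem).mpr fun i j hi hj hij => h ?_ ?_ ?_
  · simpa using Finset.mem_toList.mp (List.getElem_mem hi)
  · simpa using Finset.mem_toList.mp (List.getElem_mem hj)
  · intro he
    exact hij.ne ((List.Nodup.getElem_inj_iff S.nodup_toList).mp he)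

lemma sigmaOf_apply {S : Finset V} (h : OrthSet S) (x : V) :
    sigmaOf S x = x - ∑ β ∈ S, (2 * ⟪x, β⟫ / ⟪β, β⟫) • β := by
  rw [sigmaOf, prod_sref_apply _ h.toList, Finset.sum_map_toList]

lemma sigmaOf_of_orthogonal {S : Finset V} (h : OrthSet S) {x : V}
    (hx : ∀ β ∈ S, ⟪x, β⟫ = 0) : sigmaOf S x = x := by
  rw [sigmaOf_apply h, Finset.sum_eq_zero fun β hβ => by simp [hx β hβ], sub_zero]

lemma sigmaOf_of_mem {S : Finset V} (h : OrthSet S) {β : V} (hβ : β ∈ S) :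
    sigmaOf S β = -β := by
  rw [sigmaOf_apply h, Finset.sum_eq_single β, ← sref_apply, sref_self]
  · intro γ hγ hne
    simp [h hβ hγ hne.symm]
  · exact fun hn => absurd hβ hn

lemma sigmaOf_inner (S : Finset V) (x y : V) : ⟪sigmaOf S x, sigmaOf S y⟫ = ⟪x, y⟫ := by
  rw [sigmaOf]
  induction S.toList with
  | nil => simp
  | cons a l ih => simp [LinearEquiv.mul_apply, sref_inner, ih]

lemma sigmaOf_mul_self {S : Finset V} (h : OrthSet S) : sigmaOf S * sigmaOf S = 1 := by
  refine LinearEquiv.ext fun x => ?_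
  have h1 : ∑ β ∈ S, sigmaOf S ((2 * ⟪x, β⟫ / ⟪β, β⟫) • β) =
      -∑ β ∈ S, (2 * ⟪x, β⟫ / ⟪β, β⟫) • β := by
    rw [← Finset.sum_neg_distrib]
    exact Finset.sum_congr rfl fun β hβ => by rw [map_smul, sigmaOf_of_mem h hβ, smul_neg]
  rw [LinearEquiv.mul_apply, sigmaOf_apply h x, map_sub, map_sum, h1, sigmaOf_apply h x]
  simp

lemma image_orthSet {w : V ≃ₗ[ℝ] V} (hw : ∀ x y, ⟪w x, w y⟫ = ⟪x, y⟫) {S : Finset V}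
    (h : OrthSet S) : OrthSet (S.image fun x => w x) := by
  intro a ha b hb hab
  simp only [Finset.coe_image, Set.mem_image, Finset.mem_coe] at ha hb
  obtain ⟨a, ha, rfl⟩ := ha
  obtain ⟨b, hb, rfl⟩ := hb
  simp only [hw]
  exact h ha hb fun he => hab (by rw [he])

lemma sigmaOf_image {w : V ≃ₗ[ℝ] V} (hw : ∀ x y, ⟪w x, w y⟫ = ⟪x, y⟫) {S : Finset V}
    (h : OrthSet S) (x : V) :
    sigmaOf (S.image fun x => w x) (w x) = w (sigmaOf S x) := by
  rw [sigmaOf_apply (image_orthSet hw h), sigmaOf_apply h,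
    Finset.sum_image fun a _ b _ hab => w.injective hab]
  simp only [hw, map_sum, map_sub, map_smul]

lemma sigmaOf_eq_neg {S : Finset V} (h : OrthSet S) {x : V} (hx : sigmaOf S x = -x) :
    x = ∑ β ∈ S, (⟪x, β⟫ / ⟪β, β⟫) • β := by
  rw [sigmaOf_apply h] at hx
  have h2 : (2 : ℝ) • x = (2 : ℝ) • ∑ β ∈ S, (⟪x, β⟫ / ⟪β, β⟫) • β := by
    rw [Finset.smul_sum, two_smul]
    simp only [smul_smul, ← mul_div_assoc]
    rw [sub_eq_iff_eq_add] at hx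
    nth_rewrite 1 [hx]
    abel
  exact smul_right_injective V two_ne_zero h2

/-- The trace of an endomorphism after composing with a reflection. -/
lemma trace_sref_mul [FiniteDimensional ℝ V] (β : V) (w : V ≃ₗ[ℝ] V) :
    LinearMap.trace ℝ V (sref V β * w : V ≃ₗ[ℝ] V) =
      LinearMap.trace ℝ V w - 2 * ⟪w β, β⟫ / ⟪β, β⟫ := by
  have h : ((sref V β * w : V ≃ₗ[ℝ] V) : V →ₗ[ℝ] V) =
      (w : V →ₗ[ℝ] V) -
        (((2 / ⟪β, β⟫ : ℝ) • (innerₛₗ ℝ β)) ∘ₗ (w : V →ₗ[ℝ] V)).smulRight β := by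
    ext x
    simp only [LinearEquiv.coe_coe, LinearEquiv.mul_apply, sref_apply, LinearMap.sub_apply,
      LinearMap.smulRight_apply, LinearMap.comp_apply, LinearMap.smul_apply, innerₛₗ_apply_apply,
      smul_eq_mul, real_inner_comm β (w x)]
    congr 2
    rw [real_inner_comm]
    ring
  rw [h, map_sub, LinearMap.trace_smulRight]
  simp only [LinearMap.comp_apply, LinearMap.smul_apply, innerₛₗ_apply_apply, smul_eq_mul,
    LinearEquiv.coe_coe]
  rw [real_inner_comm β (w β)]
  ring

lemma trace_conj_sref [FiniteDimensional ℝ V] (β : V) (w : V ≃ₗ[ℝ] V) :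
    LinearMap.trace ℝ V (sref V β * w * sref V β : V ≃ₗ[ℝ] V) = LinearMap.trace ℝ V w := by
  have h1 := LinearMap.trace_mul_comm ℝ ((sref V β * w : V ≃ₗ[ℝ] V) : V →ₗ[ℝ] V)
    (sref V β : V →ₗ[ℝ] V)
  have h2 : ((sref V β : V →ₗ[ℝ] V) * ((sref V β * w : V ≃ₗ[ℝ] V) : V →ₗ[ℝ] V)) = w := by
    ext x
    exact reflMap_involutive V β (w x)
  rw [h2] at h1
  exact h1

lemma trace_sigmaOf [FiniteDimensional ℝ V] {S : Finset V} (h : OrthSet S)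
    (h0 : (0 : V) ∉ S) :
    LinearMap.trace ℝ V (sigmaOf S) = Module.finrank ℝ V - 2 * (S.card : ℝ) := by
  have hl := h.toList
  have h0 : (0 : V) ∉ S.toList := by simpa using h0
  rw [sigmaOf, ← Finset.length_toList]
  revert hl h0
  induction S.toList with
  | nil => simp
  | cons a l ih =>
    intro hl h0
    rw [List.pairwise_cons] at hl
    simp only [List.mem_cons, not_or] at h0
    have ha : (⟪a, a⟫ : ℝ) ≠ 0 := inner_self_ne_zero.mpr (Ne.symm h0.1)
    have hfix : (l.map (sref V)).prod a = a := by
      rw [prod_sref_apply l hl.2, List.sum_eq_zero, sub_zero]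
      intro x hx
      obtain ⟨b, hb, rfl⟩ := List.mem_map.mp hx
      simp [hl.1 b hb]
    rw [List.map_cons, List.prod_cons, trace_sref_mul, ih hl.2 h0.2, hfix, mul_div_assoc,
      div_self ha]
    push_cast [List.length_cons]
    ring

end Reflections

namespace RSD

variable {V}
variable (D : RSD V)

lemma span_simple : Submodule.span ℝ (D.Δ : Set V) = ⊤ := by
  rw [eq_top_iff, ← D.span_top, Submodule.span_le]
  intro α hα
  have key : ∀ c : V → ℕ, ∑ γ ∈ D.Δ, (c γ : ℝ) • γ ∈ Submodule.span ℝ (D.Δ : Set V) := fun c =>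
    Submodule.sum_mem _ fun γ hγ => Submodule.smul_mem _ _ (Submodule.subset_span hγ)
  rcases D.Δ_base α hα with ⟨c, hc⟩ | ⟨c, hc⟩
  · rw [hc]
    exact key c
  · rw [← neg_neg α, hc]
    exact Submodule.neg_mem _ (key c)

lemma exists_coweight [FiniteDimensional ℝ V] : ∃ f : V → V, ∀ γ ∈ D.Δ, ∀ δ ∈ D.Δ,
    ⟪f γ, δ⟫ = if γ = δ then 1 else 0 := by
  let b : Module.Basis (D.Δ : Set V) ℝ V := Module.Basis.mk D.Δ_indep (by
    rw [Subtype.range_coe]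
    exact D.span_simple.ge)
  refine ⟨fun γ => if h : γ ∈ (D.Δ : Set V) then
    (InnerProductSpace.toDual ℝ V).symm (LinearMap.toContinuousLinearMap (b.coord ⟨γ, h⟩))
    else 0, fun γ hγ δ hδ => ?_⟩
  beta_reduce
  rw [dif_pos (show γ ∈ (D.Δ : Set V) from hγ), InnerProductSpace.toDual_symm_apply]
  have hb : b ⟨δ, hδ⟩ = δ := Module.Basis.mk_apply _ _ _
  rw [LinearMap.coe_toContinuousLinearMap']
  nth_rewrite 1 [← hb]
  rw [Module.Basis.coord_apply, Module.Basis.repr_self, Finsupp.single_apply]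
  simp [eq_comm]

/-- The vectors dual to the simple roots: `⟪D.coweight γ, x⟫` is the coefficient of `γ` in `x`. -/
def coweight [FiniteDimensional ℝ V] : V → V := Classical.choose D.exists_coweight

variable {D}

lemma coweight_inner [FiniteDimensional ℝ V] {γ δ : V} (hγ : γ ∈ D.Δ) (hδ : δ ∈ D.Δ) :
    ⟪D.coweight γ, δ⟫ = if γ = δ then 1 else 0 :=
  Classical.choose_spec D.exists_coweight γ hγ δ hδ

lemma coweight_inner_sum [FiniteDimensional ℝ V] {γ : V} (hγ : γ ∈ D.Δ) (c : V → ℝ) :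
    ⟪D.coweight γ, ∑ δ ∈ D.Δ, c δ • δ⟫ = c γ := by
  rw [inner_sum, Finset.sum_eq_single γ]
  · simp [real_inner_smul_right, coweight_inner hγ hγ]
  · intro δ hδ hne
    simp [real_inner_smul_right, coweight_inner hγ hδ, hne.symm]
  · exact fun h => absurd hγ h

lemma eq_sum_coweight [FiniteDimensional ℝ V] (x : V) : x = ∑ γ ∈ D.Δ, ⟪D.coweight γ, x⟫ • γ := by
  have hx : x ∈ Submodule.span ℝ (D.Δ : Set V) := D.span_simple ▸ Submodule.mem_top
  obtain ⟨c, rfl⟩ := (Submodule.mem_span_finset'.mp hx)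
  have : ∑ a : D.Δ, c a • (a : V) =
      ∑ δ ∈ D.Δ, (if h : δ ∈ D.Δ then c ⟨δ, h⟩ else 0) • δ := by
    rw [← Finset.sum_coe_sort D.Δ]
    exact Finset.sum_congr rfl fun a _ => by simp
  rw [this]
  exact Finset.sum_congr rfl fun γ hγ => by rw [coweight_inner_sum hγ]

lemma eq_zero_of_coweight [FiniteDimensional ℝ V] {x : V} (h : ∀ γ ∈ D.Δ, ⟪D.coweight γ, x⟫ = 0) : x = 0 := by
  rw [eq_sum_coweight (D := D) x]
  exact Finset.sum_eq_zero fun γ hγ => by rw [h γ hγ, zero_smul]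

lemma Pos.coweight_nonneg [FiniteDimensional ℝ V] {α : V} (hα : α ∈ D.Pos) {γ : V} (hγ : γ ∈ D.Δ) :
    0 ≤ ⟪D.coweight γ, α⟫ := by
  obtain ⟨-, c, rfl⟩ := hα
  rw [coweight_inner_sum hγ]
  positivity

lemma neg_mem {α : V} (hα : α ∈ D.Φ) : -α ∈ D.Φ := by
  rw [← sref_self]
  exact D.reflClosed α hα α hα

lemma ne_zero {α : V} (hα : α ∈ D.Φ) : α ≠ 0 := fun h => D.nonzero (h ▸ hα)

lemma inner_self_pos {α : V} (hα : α ∈ D.Φ) : (0 : ℝ) < ⟪α, α⟫ :=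
  real_inner_self_pos.mpr (ne_zero hα)

lemma pos_or_neg {α : V} (hα : α ∈ D.Φ) : α ∈ D.Pos ∨ α ∈ D.Neg :=
  (D.Δ_base α hα).imp (fun h => ⟨hα, h⟩) fun h => ⟨neg_mem hα, h⟩

lemma Neg.mem {α : V} (hα : α ∈ D.Neg) : α ∈ D.Φ := by
  simpa using neg_mem hα.1

lemma mem_neg_iff {α : V} : α ∈ D.Neg ↔ -α ∈ D.Pos := Iff.rfl

lemma not_pos_neg [FiniteDimensional ℝ V] {α : V} (h : α ∈ D.Pos) (h' : α ∈ D.Neg) : False := by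
  refine ne_zero h.1 (eq_zero_of_coweight (D := D) fun γ hγ => ?_)
  have h1 := Pos.coweight_nonneg h hγ
  have h2 := Pos.coweight_nonneg h' hγ
  rw [inner_neg_right] at h2
  linarith

lemma pos_of_coweight_pos [FiniteDimensional ℝ V] {α γ : V} (hα : α ∈ D.Φ) (hγ : γ ∈ D.Δ)
    (h : 0 < ⟪D.coweight γ, α⟫) : α ∈ D.Pos := by
  refine (pos_or_neg hα).resolve_right fun hn => ?_
  have h2 := Pos.coweight_nonneg hn hγ
  rw [inner_neg_right] at h2
  linarith

lemma simple_pos {α : V} (hα : α ∈ D.Δ) : α ∈ D.Pos := by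
  refine ⟨D.Δ_sub hα, fun γ => if γ = α then 1 else 0, ?_⟩
  rw [Finset.sum_eq_single α]
  · simp
  · intro δ _ hne
    simp [hne]
  · exact fun h => absurd hα h

/-- A simple reflection permutes the other positive roots. -/
lemma sref_pos [FiniteDimensional ℝ V] {α β : V} (hα : α ∈ D.Δ) (hβ : β ∈ D.Pos) (hne : β ≠ α) :
    sref V α β ∈ D.Pos := by
  have hex : ∃ δ ∈ D.Δ, δ ≠ α ∧ 0 < ⟪D.coweight δ, β⟫ := by
    by_contra! hcon
    have hz : ∀ δ ∈ D.Δ, δ ≠ α → ⟪D.coweight δ, β⟫ = 0 := fun δ hδ hδα =>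
      le_antisymm (hcon δ hδ hδα) (Pos.coweight_nonneg hβ hδ)
    have hβα : β = ⟪D.coweight α, β⟫ • α := by
      conv_lhs => rw [eq_sum_coweight (D := D) β]
      refine Finset.sum_eq_single α (fun δ hδ hδα => ?_) fun h => absurd hα h
      rw [hz δ hδ hδα, zero_smul]
    have hc := Pos.coweight_nonneg hβ hα
    rcases D.reduced α (D.Δ_sub hα) _ (hβα ▸ hβ.1) with h | h
    · rw [h, one_smul] at hβα
      exact hne hβα
    · linarith
  obtain ⟨δ, hδ, hδα, hpos⟩ := hex
  refine pos_of_coweight_pos (D.reflClosed α (D.Δ_sub hα) β hβ.1) hδ ?_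
  rw [sref_apply, inner_sub_right, real_inner_smul_right, coweight_inner hδ hα, if_neg hδα]
  simpa using hpos

lemma sref_mem_W {α : V} (hα : α ∈ D.Δ) : sref V α ∈ D.W :=
  Subgroup.subset_closure ⟨α, hα, rfl⟩

lemma W_inner {w : V ≃ₗ[ℝ] V} (hw : w ∈ D.W) : ∀ x y, ⟪w x, w y⟫ = ⟪x, y⟫ := by
  induction hw using Subgroup.closure_induction with
  | mem w hw =>
    obtain ⟨α, -, rfl⟩ := hw
    exact sref_inner α
  | one => exact fun _ _ => rfl
  | mul a b _ _ ha hb => exact fun x y => (ha _ _).trans (hb x y)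
  | inv a _ ha =>
    intro x y
    rw [← ha, ← LinearEquiv.mul_apply, ← LinearEquiv.mul_apply, mul_inv_cancel]
    rfl

lemma W_root {w : V ≃ₗ[ℝ] V} (hw : w ∈ D.W) : ∀ α ∈ D.Φ, w α ∈ D.Φ := by
  induction hw using Subgroup.closure_induction_left with
  | one => exact fun _ h => h
  | mul_left s hs w _ ih =>
    obtain ⟨γ, hγ, rfl⟩ := hs
    exact fun α hα => D.reflClosed γ (D.Δ_sub hγ) _ (ih α hα)
  | inv_mul_cancel s hs w _ ih =>
    obtain ⟨γ, hγ, rfl⟩ := hs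
    intro α hα
    change ((sref V γ)⁻¹ * w) α ∈ _
    rw [sref_inv]
    exact D.reflClosed γ (D.Δ_sub hγ) _ (ih α hα)

lemma W_inner_left {w : V ≃ₗ[ℝ] V} (hw : w ∈ D.W) (x y : V) : ⟪w x, y⟫ = ⟪x, w⁻¹ y⟫ := by
  rw [← W_inner hw x, ← LinearEquiv.mul_apply w, mul_inv_cancel, LinearEquiv.coe_one, id]

lemma sref_mem_W_of_pos [FiniteDimensional ℝ V] {β : V} (hβ : β ∈ D.Pos) : sref V β ∈ D.W := by
  obtain ⟨c, hc⟩ := hβ.2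
  induction hn : ∑ γ ∈ D.Δ, c γ using Nat.strong_induction_on generalizing β c with
  | _ n ih =>
    by_cases hs : β ∈ D.Δ
    · exact sref_mem_W hs
    have hex : ∃ γ ∈ D.Δ, 0 < (c γ : ℝ) * ⟪γ, β⟫ := by
      apply Finset.exists_lt_of_sum_lt (f := fun _ => (0 : ℝ))
      have := inner_self_pos hβ.1
      nth_rewrite 1 [hc] at this
      simpa [sum_inner, real_inner_smul_left] using this
    obtain ⟨γ, hγ, hpos⟩ := hex
    have hγβ : 0 < ⟪γ, β⟫ := by
      by_contra! h
      have := mul_nonpos_of_nonneg_of_nonpos (Nat.cast_nonneg (α := ℝ) (c γ)) h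
      linarith
    have hne : β ≠ γ := fun h => hs (h ▸ hγ)
    have hP := sref_pos hγ hβ hne
    obtain ⟨d, hd⟩ := hP.2
    have hsum : ∀ (x : V) (e : V → ℕ), x = ∑ δ ∈ D.Δ, (e δ : ℝ) • δ →
        ((∑ δ ∈ D.Δ, e δ : ℕ) : ℝ) = ⟪∑ δ ∈ D.Δ, D.coweight δ, x⟫ := by
      intro x e he
      rw [sum_inner, Nat.cast_sum]
      exact Finset.sum_congr rfl fun δ hδ => by
        rw [he, coweight_inner_sum hδ fun δ => (e δ : ℝ)]
    have hγ1 : ⟪∑ δ ∈ D.Δ, D.coweight δ, γ⟫ = 1 := by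
      rw [sum_inner, Finset.sum_eq_single γ]
      · simp [coweight_inner hγ hγ]
      · intro δ hδ h
        simp [coweight_inner hδ hγ, h]
      · exact fun h => absurd hγ h
    have hlt : ∑ δ ∈ D.Δ, d δ < n := by
      rw [← hn]
      have : ((∑ δ ∈ D.Δ, d δ : ℕ) : ℝ) < ((∑ δ ∈ D.Δ, c δ : ℕ) : ℝ) := by
        rw [hsum _ _ hd, hsum _ _ hc, sref_apply, inner_sub_right, real_inner_smul_right, hγ1,
          real_inner_comm γ β]
        have := inner_self_pos (D.Δ_sub hγ)
        have : 0 < 2 * ⟪γ, β⟫ / ⟪γ, γ⟫ := by positivity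
        linarith
      exact_mod_cast this
    have hW := ih _ hlt hP d hd rfl
    have heq : sref V β = sref V γ * sref V (sref V γ β) * sref V γ := by
      rw [mul_assoc, ← mul_sref (sref_inner γ), sref_mul_cancel_left]
    rw [heq]
    exact mul_mem (mul_mem (sref_mem_W hγ) hW) (sref_mem_W hγ)

lemma sref_mem_W_of_root [FiniteDimensional ℝ V] {β : V} (hβ : β ∈ D.Φ) : sref V β ∈ D.W := by
  rcases pos_or_neg hβ with h | h
  · exact sref_mem_W_of_pos h
  · rw [← sref_neg]
    exact sref_mem_W_of_pos h

lemma sigmaOf_mem_W [FiniteDimensional ℝ V] {S : Finset V} (hS : ∀ β ∈ S, β ∈ D.Φ) : sigmaOf S ∈ D.W := by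
  refine Subgroup.list_prod_mem _ fun x hx => ?_
  obtain ⟨β, hβ, rfl⟩ := List.mem_map.mp hx
  exact sref_mem_W_of_root (hS β (Finset.mem_toList.mp hβ))

section Length


lemma exists_word {w : V ≃ₗ[ℝ] V} (hw : w ∈ D.W) :
    ∃ l : List V, (∀ γ ∈ l, γ ∈ D.Δ) ∧ w = (l.map (sref V)).prod := by
  have key : ∀ s ∈ (fun γ => sref V γ) '' (D.Δ : Set V), ∀ w : V ≃ₗ[ℝ] V,
      (∃ l : List V, (∀ γ ∈ l, γ ∈ D.Δ) ∧ w = (l.map (sref V)).prod) →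
      ∃ l : List V, (∀ γ ∈ l, γ ∈ D.Δ) ∧ s * w = (l.map (sref V)).prod := by
    rintro _ ⟨γ, hγ, rfl⟩ w ⟨l, hl, rfl⟩
    exact ⟨γ :: l, by simpa using ⟨hγ, hl⟩, by simp⟩
  induction hw using Subgroup.closure_induction_left with
  | one => exact ⟨[], by simp, by simp⟩
  | mul_left s hs w _ ih => exact key s hs w ih
  | inv_mul_cancel s hs w _ ih =>
    obtain ⟨γ, hγ, rfl⟩ := hs
    simp only [sref_inv]
    exact key _ ⟨γ, hγ, rfl⟩ w ih

lemma length_le (l : List V) (hl : ∀ γ ∈ l, γ ∈ D.Δ) :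
    D.length (l.map (sref V)).prod ≤ l.length :=
  Nat.sInf_le ⟨l, rfl, hl, rfl⟩

lemma exists_reduced_word {w : V ≃ₗ[ℝ] V} (hw : w ∈ D.W) :
    ∃ l : List V, l.length = D.length w ∧ (∀ γ ∈ l, γ ∈ D.Δ) ∧ w = (l.map (sref V)).prod := by
  obtain ⟨l, hl⟩ := exists_word hw
  exact Nat.sInf_mem (s := {n | ∃ l : List V, l.length = n ∧ (∀ γ ∈ l, γ ∈ D.Δ) ∧
    w = (l.map (sref V)).prod}) ⟨l.length, l, rfl, hl⟩

lemma length_inv_le {w : V ≃ₗ[ℝ] V} (hw : w ∈ D.W) : D.length w⁻¹ ≤ D.length w := by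
  obtain ⟨l, hl, hΔ, hw⟩ := exists_reduced_word hw
  have hinv : w⁻¹ = (l.reverse.map (sref V)).prod := by
    rw [hw, List.prod_inv_reverse, List.map_map, ← List.map_reverse]
    congr 2
  rw [← hl, hinv, ← List.length_reverse]
  exact length_le _ (by simpa using hΔ)

lemma length_inv {w : V ≃ₗ[ℝ] V} (hw : w ∈ D.W) : D.length w⁻¹ = D.length w :=
  le_antisymm (length_inv_le hw) (by simpa using length_inv_le (inv_mem hw))

lemma length_sref_mul_le {α : V} {w : V ≃ₗ[ℝ] V} (hα : α ∈ D.Δ) (hw : w ∈ D.W) :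
    D.length (sref V α * w) ≤ D.length w + 1 := by
  obtain ⟨l, hl, hΔ, hw⟩ := exists_reduced_word hw
  rw [← hl, hw, ← List.prod_cons, ← List.map_cons, ← List.length_cons (a := α)]
  exact length_le _ (by simpa using ⟨hα, hΔ⟩)

lemma eq_one_of_length_eq_zero {w : V ≃ₗ[ℝ] V} (hw : w ∈ D.W) (h : D.length w = 0) : w = 1 := by
  obtain ⟨l, hl, -, hw⟩ := exists_reduced_word hw
  rw [h, List.length_eq_zero_iff] at hl
  simpa [hl] using hw

end Length

/-- The strong exchange property. -/
lemma strong_exchange [FiniteDimensional ℝ V] (l : List V) (hl : ∀ γ ∈ l, γ ∈ D.Δ) {β : V} (hβ : β ∈ D.Pos)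
    (hneg : (l.map (sref V)).prod⁻¹ β ∈ D.Neg) :
    ∃ l' : List V, l'.length < l.length ∧ (∀ γ ∈ l', γ ∈ D.Δ) ∧
      sref V β * (l.map (sref V)).prod = (l'.map (sref V)).prod := by
  induction l generalizing β with
  | nil => exact (not_pos_neg hβ (by simpa using hneg)).elim
  | cons α l ih =>
    have hα : α ∈ D.Δ := hl α (by simp)
    have hl' : ∀ γ ∈ l, γ ∈ D.Δ := fun γ hγ => hl γ (by simp [hγ])
    by_cases hne : β = α
    · exact ⟨l, by simp, hl', by rw [hne, List.map_cons, List.prod_cons, sref_mul_cancel_left]⟩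
    · have hneg' : (l.map (sref V)).prod⁻¹ (sref V α β) ∈ D.Neg := by
        rw [List.map_cons, List.prod_cons, mul_inv_rev, sref_inv] at hneg
        exact hneg
      obtain ⟨m, hm, hmΔ, hprod⟩ := ih hl' (sref_pos hα hβ hne) hneg'
      refine ⟨α :: m, by simpa using hm, by simpa using ⟨hα, hmΔ⟩, ?_⟩
      rw [List.map_cons, List.prod_cons, List.map_cons, List.prod_cons, ← hprod, ← mul_assoc,
        ← mul_assoc, mul_sref (sref_inner α), ← LinearEquiv.mul_apply, sref_mul_self]
      rfl

lemma length_sref_mul_lt [FiniteDimensional ℝ V] {w : V ≃ₗ[ℝ] V} (hw : w ∈ D.W) {β : V} (hβ : β ∈ D.Pos)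
    (hneg : w⁻¹ β ∈ D.Neg) : D.length (sref V β * w) < D.length w := by
  obtain ⟨l, hl, hΔ, rfl⟩ := exists_reduced_word hw
  obtain ⟨m, hm, hmΔ, hprod⟩ := strong_exchange l hΔ hβ hneg
  rw [← hl, hprod]
  exact (length_le m hmΔ).trans_lt hm

lemma lt_length_sref_mul [FiniteDimensional ℝ V] {w : V ≃ₗ[ℝ] V} (hw : w ∈ D.W) {β : V} (hβ : β ∈ D.Pos)
    (hpos : w⁻¹ β ∈ D.Pos) : D.length w < D.length (sref V β * w) := by
  have h := length_sref_mul_lt (mul_mem (sref_mem_W_of_pos hβ) hw) hβ (by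
    rw [mul_inv_rev, sref_inv, LinearEquiv.mul_apply, sref_self, map_neg]
    simpa [Neg] using hpos)
  rwa [sref_mul_cancel_left] at h

lemma inv_apply_pos_of_length_lt [FiniteDimensional ℝ V] {w : V ≃ₗ[ℝ] V} (hw : w ∈ D.W) {β : V} (hβ : β ∈ D.Pos)
    (h : D.length w < D.length (sref V β * w)) : w⁻¹ β ∈ D.Pos :=
  (pos_or_neg (W_root (inv_mem hw) β hβ.1)).resolve_right fun hn =>
    (h.trans (length_sref_mul_lt hw hβ hn)).false

lemma length_sref_mul_add_one [FiniteDimensional ℝ V] {w : V ≃ₗ[ℝ] V} (hw : w ∈ D.W) {α : V} (hα : α ∈ D.Δ)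
    (hneg : w⁻¹ α ∈ D.Neg) : D.length (sref V α * w) + 1 = D.length w := by
  have h1 := length_sref_mul_lt hw (simple_pos hα) hneg
  have h2 := length_sref_mul_le hα (mul_mem (sref_mem_W hα) hw)
  rw [sref_mul_cancel_left] at h2
  omega

lemma exists_descent [FiniteDimensional ℝ V] {w : V ≃ₗ[ℝ] V} (hw : w ∈ D.W) (h1 : w ≠ 1) :
    ∃ α ∈ D.Δ, w⁻¹ α ∈ D.Neg := by
  obtain ⟨l, hl, hΔ, hprod⟩ := exists_reduced_word hw
  cases l with
  | nil => exact (h1 (by simpa using hprod)).elim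
  | cons α l =>
    have hα : α ∈ D.Δ := hΔ α (by simp)
    refine ⟨α, hα, (pos_or_neg (W_root (inv_mem hw) α (D.Δ_sub hα))).resolve_left fun hp => ?_⟩
    have h2 := lt_length_sref_mul hw (simple_pos hα) hp
    have h3 : sref V α * w = (l.map (sref V)).prod := by
      rw [hprod, List.map_cons, List.prod_cons, sref_mul_cancel_left]
    have h4 := length_le (D := D) l fun γ hγ => hΔ γ (by simp [hγ])
    rw [h3, ← hl, List.length_cons] at h2
    omega

/-- An element of the Weyl group preserving the positive roots is trivial. -/
lemma eq_one_of_map_pos [FiniteDimensional ℝ V] {w : V ≃ₗ[ℝ] V} (hw : w ∈ D.W)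
    (h : ∀ α ∈ D.Pos, w α ∈ D.Pos) : w = 1 := by
  by_contra hne
  obtain ⟨α, hα, hneg⟩ := exists_descent (inv_mem hw) (by simpa using hne)
  rw [inv_inv] at hneg
  exact not_pos_neg (h α (simple_pos hα)) hneg

end RSD

namespace RSD

variable {V}
variable {D : RSD V}

lemma mem_W_of_step [FiniteDimensional ℝ V] {x y : V ≃ₗ[ℝ] V} (hx : x ∈ D.W)
    (h : (∃ β ∈ D.Φ, y = sref V β * x) ∧ D.length x < D.length y) : y ∈ D.W := by
  obtain ⟨⟨β, hβ, rfl⟩, -⟩ := h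
  exact mul_mem (sref_mem_W_of_root hβ) hx

/-- A covering reflection in the Bruhat order, with the root taken positive. -/
lemma step_pos [FiniteDimensional ℝ V] {x y : V ≃ₗ[ℝ] V} (hx : x ∈ D.W)
    (h : (∃ β ∈ D.Φ, y = sref V β * x) ∧ D.length x < D.length y) :
    ∃ β ∈ D.Pos, y = sref V β * x ∧ x⁻¹ β ∈ D.Pos := by
  obtain ⟨⟨β, hβ, rfl⟩, hlt⟩ := h
  rcases pos_or_neg hβ with hp | hn
  · exact ⟨β, hp, rfl, inv_apply_pos_of_length_lt hx hp hlt⟩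
  · rw [← sref_neg] at hlt ⊢
    exact ⟨-β, hn, rfl, inv_apply_pos_of_length_lt hx hn hlt⟩

lemma ble_sref_mul [FiniteDimensional ℝ V] {x : V ≃ₗ[ℝ] V} (hx : x ∈ D.W) {β : V} (hβ : β ∈ D.Pos)
    (h : x⁻¹ β ∈ D.Pos) : D.ble x (sref V β * x) :=
  Relation.ReflTransGen.single ⟨⟨β, hβ.1, rfl⟩, lt_length_sref_mul hx hβ h⟩

/-- Induction along the Bruhat order, starting from an element of the Weyl group. -/
lemma ble_induction [FiniteDimensional ℝ V] {x y : V ≃ₗ[ℝ] V} (hx : x ∈ D.W) (h : D.ble x y)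
    {p : (V ≃ₗ[ℝ] V) → Prop} (refl : p x)
    (step : ∀ z ∈ D.W, ∀ β ∈ D.Pos, z⁻¹ β ∈ D.Pos → p z → p (sref V β * z)) : p y := by
  have key : y ∈ D.W ∧ p y := by
    induction h with
    | refl => exact ⟨hx, refl⟩
    | tail _ hs ih =>
      refine ⟨mem_W_of_step ih.1 hs, ?_⟩
      obtain ⟨β, hβ, rfl, hpos⟩ := step_pos ih.1 hs
      exact step _ ih.1 β hβ hpos ih.2
  exact key.2

lemma ble_length [FiniteDimensional ℝ V] {x y : V ≃ₗ[ℝ] V} (hx : x ∈ D.W) (h : D.ble x y) :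
    D.length x ≤ D.length y :=
  ble_induction (p := fun y => D.length x ≤ D.length y) hx h le_rfl fun _ hz _ hβ hpos ih => ih.trans (lt_length_sref_mul hz hβ hpos).le

lemma ble_inv [FiniteDimensional ℝ V] {x y : V ≃ₗ[ℝ] V} (hx : x ∈ D.W) (h : D.ble x y) : D.ble x⁻¹ y⁻¹ := by
  refine ble_induction (p := fun y => D.ble x⁻¹ y⁻¹) hx h Relation.ReflTransGen.refl fun z hz β hβ hpos ih => ih.trans ?_
  have heq : (sref V β * z)⁻¹ = sref V (z⁻¹ β) * z⁻¹ := by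
    rw [mul_inv_rev, sref_inv, mul_sref (W_inner (inv_mem hz))]
  rw [heq]
  refine ble_sref_mul (inv_mem hz) hpos ?_
  rwa [inv_inv, ← LinearEquiv.mul_apply, mul_inv_cancel]

variable (D) in
/-- The smaller of `w` and `s_α w`. -/
def lower (α : V) (w : V ≃ₗ[ℝ] V) : V ≃ₗ[ℝ] V :=
  if w⁻¹ α ∈ D.Neg then sref V α * w else w

lemma lower_mem_W {α : V} (hα : α ∈ D.Δ) {w : V ≃ₗ[ℝ] V} (hw : w ∈ D.W) :
    D.lower α w ∈ D.W := by
  rw [lower]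
  split_ifs
  · exact mul_mem (sref_mem_W hα) hw
  · exact hw

/-- The lifting property of the Bruhat order. -/
lemma lower_mono [FiniteDimensional ℝ V] {α : V} (hα : α ∈ D.Δ) {x y : V ≃ₗ[ℝ] V} (hx : x ∈ D.W) (h : D.ble x y) :
    D.ble (D.lower α x) (D.lower α y) := by
  refine ble_induction (p := fun y => D.ble (D.lower α x) (D.lower α y)) hx h Relation.ReflTransGen.refl fun z hz β hβ hpos ih => ih.trans ?_
  have hαP := simple_pos hα
  have hup : D.ble z (sref V β * z) := ble_sref_mul hz hβ hpos
  by_cases hβα : β = α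
  · subst hβα
    have h1 : ¬ z⁻¹ β ∈ D.Neg := not_pos_neg hpos
    have h2 : (sref V β * z)⁻¹ β ∈ D.Neg := by
      rw [mul_inv_rev, sref_inv, LinearEquiv.mul_apply, sref_self, map_neg]
      simpa [Neg] using hpos
    rw [lower, lower, if_neg h1, if_pos h2, sref_mul_cancel_left]
  have hstep : D.ble (sref V α * z) (sref V α * (sref V β * z)) := by
    rw [← mul_assoc, mul_sref (sref_inner α), mul_assoc]
    refine ble_sref_mul (mul_mem (sref_mem_W hα) hz) (sref_pos hα hβ hβα) ?_
    rw [mul_inv_rev, sref_inv, LinearEquiv.mul_apply, ← LinearEquiv.mul_apply (sref V α),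
      sref_mul_self]
    exact hpos
  have hle : ∀ w ∈ D.W, w⁻¹ α ∈ D.Neg → D.ble (sref V α * w) w := fun w hw hneg => by
    have := ble_sref_mul (mul_mem (sref_mem_W hα) hw) hαP (by
      rw [mul_inv_rev, sref_inv, LinearEquiv.mul_apply, sref_self, map_neg]
      exact hneg)
    rwa [sref_mul_cancel_left] at this
  rw [lower, lower]
  split_ifs with h1 h2 h2
  · exact hstep
  · exact (hle z hz h1).trans hup
  · refine Relation.ReflTransGen.trans (ble_sref_mul hz hαP ?_) hstep
    exact (pos_or_neg (W_root (inv_mem hz) α hαP.1)).resolve_right h1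
  · exact hup

variable (D) in
/-- The twisted-conjugation analogue of `lower`, which preserves involutions. -/
def lowerInv (α : V) (w : V ≃ₗ[ℝ] V) : V ≃ₗ[ℝ] V :=
  (D.lower α (D.lower α w)⁻¹)⁻¹

lemma lowerInv_mono [FiniteDimensional ℝ V] {α : V} (hα : α ∈ D.Δ) {x y : V ≃ₗ[ℝ] V} (hx : x ∈ D.W)
    (h : D.ble x y) : D.ble (D.lowerInv α x) (D.lowerInv α y) :=
  ble_inv (lower_mem_W hα (inv_mem (lower_mem_W hα hx)))
    (lower_mono hα (inv_mem (lower_mem_W hα hx)) (ble_inv (lower_mem_W hα hx)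
      (lower_mono hα hx h)))

lemma lowerInv_of_pos [FiniteDimensional ℝ V] {α : V} {w : V ≃ₗ[ℝ] V} (hinv : w * w = 1) (h : w α ∈ D.Pos) :
    D.lowerInv α w = w := by
  have hw : w⁻¹ = w := inv_eq_of_mul_eq_one_right hinv
  have hl : D.lower α w = w := by
    rw [lower, if_neg]
    rw [hw]
    exact not_pos_neg h
  rw [lowerInv, hl, hw, hl, hw]

lemma lowerInv_of_eq_neg [FiniteDimensional ℝ V] {α : V} (hα : α ∈ D.Δ) {w : V ≃ₗ[ℝ] V} (hinv : w * w = 1)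
    (h : w α = -α) :
    D.lowerInv α w = sref V α * w := by
  have hwi : w⁻¹ = w := inv_eq_of_mul_eq_one_right hinv
  have hneg : w⁻¹ α ∈ D.Neg := by
    rw [hwi, h, mem_neg_iff, neg_neg]
    exact simple_pos hα
  rw [lowerInv, lower, lower, if_pos hneg, if_neg, inv_inv]
  rw [inv_inv, LinearEquiv.mul_apply, h, map_neg, sref_self, neg_neg]
  exact not_pos_neg (simple_pos hα)

lemma lowerInv_of_neg [FiniteDimensional ℝ V] {α : V} (hα : α ∈ D.Δ) {w : V ≃ₗ[ℝ] V}
    (hinv : w * w = 1) (h : w α ∈ D.Neg) (hne : w α ≠ -α) :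
    D.lowerInv α w = sref V α * w * sref V α := by
  have hwi : w⁻¹ = w := inv_eq_of_mul_eq_one_right hinv
  rw [lowerInv, lower, lower, hwi, if_pos h, if_pos, mul_inv_rev, inv_inv, sref_inv]
  rw [inv_inv, LinearEquiv.mul_apply, mem_neg_iff, ← map_neg]
  exact sref_pos hα h fun he => hne (by nth_rewrite 2 [← he]; rw [neg_neg])

variable (D) in
/-- Up to normalization, the rank `(ℓ + λ)/2` of an involution, with the dimension `λ` of the
`(-1)`-eigenspace expressed through the trace. -/
def traceRank (w : V ≃ₗ[ℝ] V) : ℝ :=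
  2 * D.length w - LinearMap.trace ℝ V w

lemma lowerInv_spec [FiniteDimensional ℝ V] {α : V} (hα : α ∈ D.Δ) {w : V ≃ₗ[ℝ] V} (hw : w ∈ D.W)
    (hinv : w * w = 1) (h : w α ∈ D.Neg) :
    D.lowerInv α w * D.lowerInv α w = 1 ∧ D.length (D.lowerInv α w) < D.length w ∧
      D.traceRank (D.lowerInv α w) = D.traceRank w - 4 := by
  have hwi : w⁻¹ = w := inv_eq_of_mul_eq_one_right hinv
  have hneg : w⁻¹ α ∈ D.Neg := by rwa [hwi]
  have hsW := sref_mem_W hα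
  have hlen := length_sref_mul_add_one hw hα hneg
  have hlenR : (D.length (sref V α * w) : ℝ) + 1 = D.length w := by exact_mod_cast hlen
  by_cases he : w α = -α
  · rw [lowerInv_of_eq_neg hα hinv he]
    refine ⟨?_, by omega, ?_⟩
    · have hcomm : w * sref V α = sref V α * w := by
        rw [mul_sref (W_inner hw), he, sref_neg]
      rw [mul_assoc, ← mul_assoc w, hcomm, mul_assoc, hinv, mul_one, sref_mul_self]
    · have := (inner_self_pos (D.Δ_sub hα)).ne'
      rw [traceRank, traceRank, trace_sref_mul, he, inner_neg_left, mul_neg, neg_div,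
        mul_div_assoc, div_self this]
      linarith
  · rw [lowerInv_of_neg hα hinv h he]
    have hx : w * sref V α ∈ D.W := mul_mem hw hsW
    have h1 : D.length (w * sref V α) = D.length (sref V α * w) := by
      rw [← length_inv hx, mul_inv_rev, sref_inv, hwi]
    have h2 := length_sref_mul_add_one hx hα (by
      rw [mul_inv_rev, sref_inv, hwi, LinearEquiv.mul_apply, mem_neg_iff, ← map_neg]
      exact sref_pos hα h fun h' => he (by nth_rewrite 2 [← h']; rw [neg_neg]))
    rw [← mul_assoc] at h2
    refine ⟨?_, by omega, ?_⟩
    · rw [mul_assoc (sref V α) w, mul_assoc, mul_assoc w, sref_mul_cancel_left, ← mul_assoc w,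
        hinv, one_mul, sref_mul_self]
    · have h3 : (D.length (sref V α * w * sref V α) : ℝ) + 1 + 1 = D.length w := by
        exact_mod_cast (by omega : D.length (sref V α * w * sref V α) + 1 + 1 = D.length w)
      rw [traceRank, traceRank, trace_conj_sref]
      linarith

lemma lowerInv_mem_W {α : V} (hα : α ∈ D.Δ) {w : V ≃ₗ[ℝ] V} (hw : w ∈ D.W) :
    D.lowerInv α w ∈ D.W :=
  inv_mem (lower_mem_W hα (inv_mem (lower_mem_W hα hw)))

lemma lowerInv_injective [FiniteDimensional ℝ V] {α : V} (hα : α ∈ D.Δ) {x y : V ≃ₗ[ℝ] V} (hx2 : x * x = 1) (hy2 : y * y = 1) (hxα : x α ∈ D.Neg)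
    (hyα : y α ∈ D.Neg) (h : D.lowerInv α x = D.lowerInv α y) : x = y := by
  have key : ∀ {z : V ≃ₗ[ℝ] V}, z α ∈ D.Neg → (sref V α * z * sref V α) α ≠ α := by
    intro z hz he
    rw [LinearEquiv.mul_apply, LinearEquiv.mul_apply, sref_self, map_neg, map_neg] at he
    have h1 := congrArg (sref V α) he
    rw [map_neg, ← LinearEquiv.mul_apply, sref_mul_self, sref_self] at h1
    have h2 : z α = α := neg_injective h1
    exact not_pos_neg (simple_pos hα) (h2 ▸ hz)
  have key' : ∀ {z : V ≃ₗ[ℝ] V}, z α = -α → (sref V α * z) α = α := fun hz => by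
    rw [LinearEquiv.mul_apply, hz, map_neg, sref_self, neg_neg]
  by_cases h1 : x α = -α <;> by_cases h2 : y α = -α
  · rw [lowerInv_of_eq_neg hα hx2 h1, lowerInv_of_eq_neg hα hy2 h2] at h
    exact mul_left_cancel h
  · rw [lowerInv_of_eq_neg hα hx2 h1, lowerInv_of_neg hα hy2 hyα h2] at h
    exact (key hyα (h ▸ key' h1)).elim
  · rw [lowerInv_of_neg hα hx2 hxα h1, lowerInv_of_eq_neg hα hy2 h2] at h
    exact (key hxα (h ▸ key' h2)).elim
  · rw [lowerInv_of_neg hα hx2 hxα h1, lowerInv_of_neg hα hy2 hyα h2] at h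
    exact mul_left_cancel (mul_right_cancel h)

/-- The rank is strictly increasing for the Bruhat order on involutions. -/
lemma eq_of_ble_of_traceRank_le [FiniteDimensional ℝ V] {x y : V ≃ₗ[ℝ] V} (hx : x ∈ D.W) (hy : y ∈ D.W)
    (hx2 : x * x = 1) (hy2 : y * y = 1) (hle : D.ble x y)
    (hr : D.traceRank y ≤ D.traceRank x) : x = y := by
  induction hn : D.length y using Nat.strong_induction_on generalizing x y with
  | _ n ih =>
    by_cases hy1 : y = 1
    · have h0 : D.length (1 : V ≃ₗ[ℝ] V) = 0 := by
        simpa using length_le (D := D) [] (by simp)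
      have := ble_length hx hle
      rw [hy1, h0, Nat.le_zero] at this
      rw [hy1, eq_one_of_length_eq_zero hx this]
    · obtain ⟨α, hα, hyα⟩ := exists_descent hy hy1
      rw [inv_eq_of_mul_eq_one_right hy2] at hyα
      obtain ⟨hy2', hlt, hry⟩ := lowerInv_spec hα hy hy2 hyα
      have hle' := lowerInv_mono hα hx hle
      rcases pos_or_neg (W_root hx α (D.Δ_sub hα)) with hp | hneg
      · rw [lowerInv_of_pos hx2 hp] at hle'
        have := ih _ (hn ▸ hlt) hx (lowerInv_mem_W hα hy) hx2 hy2' hle' (by linarith) rfl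
        rw [this] at hr
        linarith
      · obtain ⟨hx2', -, hrx⟩ := lowerInv_spec hα hx hx2 hneg
        exact lowerInv_injective hα hx2 hy2 hneg hyα
          (ih _ (hn ▸ hlt) (lowerInv_mem_W hα hx) (lowerInv_mem_W hα hy) hx2' hy2' hle'
            (by linarith) rfl)

end RSD

namespace RSD

variable {V}
variable {D : RSD V}

lemma pos_of_coweight_nonneg [FiniteDimensional ℝ V] {α : V} (hα : α ∈ D.Φ)
    (h : ∀ γ ∈ D.Δ, 0 ≤ ⟪D.coweight γ, α⟫) : α ∈ D.Pos := by
  refine (pos_or_neg hα).resolve_right fun hn => ne_zero hα ?_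
  refine eq_zero_of_coweight (D := D) fun γ hγ => le_antisymm ?_ (h γ hγ)
  have := Pos.coweight_nonneg hn hγ
  rw [inner_neg_right] at this
  linarith

lemma sigmaOf_root {S : Finset V} (hS : ∀ β ∈ S, β ∈ D.Φ) {α : V} (hα : α ∈ D.Φ) :
    sigmaOf S α ∈ D.Φ := by
  have hS' : ∀ β ∈ S.toList, β ∈ D.Φ := fun β hβ => hS β (Finset.mem_toList.mp hβ)
  rw [sigmaOf]
  revert hS'
  induction S.toList with
  | nil => simpa using hα
  | cons β l ih =>
    intro hS'
    rw [List.map_cons, List.prod_cons]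
    exact D.reflClosed β (hS' β (by simp)) _ (ih fun γ hγ => hS' γ (by simp [hγ]))

/-- If `y` is a minuscule coweight equal to `1` on an orthogonal set `B`, then the roots in the
span of `B` have coordinates of total absolute value at most `1`. -/
lemma sum_abs_coord_le_one {B : Finset V} (hB : ∀ β ∈ B, β ∈ D.Φ) (hBo : OrthSet B) {y : V}
    (hy : ∀ α ∈ D.Φ, ⟪y, α⟫ ≤ 1) (hy1 : ∀ β ∈ B, ⟪y, β⟫ = 1) {α : V} (hα : α ∈ D.Φ)
    (hσ : sigmaOf B α = -α) : ∑ β ∈ B, |⟪α, β⟫ / ⟪β, β⟫| ≤ 1 := by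
  set N := B.filter fun β => ⟪α, β⟫ < 0
  have hroot : sigmaOf N α ∈ D.Φ := sigmaOf_root (fun β hβ => hB β (Finset.mem_filter.mp hβ).1) hα
  have heq : sigmaOf N α = ∑ β ∈ B, |⟪α, β⟫ / ⟪β, β⟫| • β := by
    rw [sigmaOf_apply (hBo.subset (Finset.filter_subset _ _)), Finset.sum_filter]
    nth_rewrite 1 [sigmaOf_eq_neg hBo hσ]
    rw [← Finset.sum_sub_distrib]
    refine Finset.sum_congr rfl fun β hβ => ?_
    have hpos := inner_self_pos (hB β hβ)
    split_ifs with h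
    · rw [abs_of_neg (div_neg_of_neg_of_pos h hpos), ← sub_smul]
      congr 1
      ring
    · rw [sub_zero, abs_of_nonneg (div_nonneg (not_lt.mp h) hpos.le)]
  have h1 := hy _ hroot
  rw [heq, inner_sum] at h1
  rwa [Finset.sum_congr rfl fun β hβ => by
    rw [real_inner_smul_right, hy1 β hβ, mul_one]] at h1

lemma mem_of_maximal_norm [FiniteDimensional ℝ V] {A B : Finset V} (hA : ∀ β ∈ A, β ∈ D.Neg) (hB : ∀ β ∈ B, β ∈ D.Neg)
    (hAo : OrthSet A) (hBo : OrthSet B) (hσ : sigmaOf A = sigmaOf B) {y : V}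
    (hy : ∀ α ∈ D.Φ, ⟪y, α⟫ ≤ 1) (hy1 : ∀ β ∈ B, ⟪y, β⟫ = 1) {α : V} (hα : α ∈ A)
    (hmax : ∀ β ∈ B, β ∉ A → ⟪β, β⟫ ≤ ⟪α, α⟫) : α ∈ B := by
  by_contra hαB
  have hBΦ : ∀ β ∈ B, β ∈ D.Φ := fun β hβ => Neg.mem (hB β hβ)
  have hαΦ := Neg.mem (hA α hα)
  have hαα := inner_self_pos hαΦ
  have hneg : sigmaOf B α = -α := hσ ▸ sigmaOf_of_mem hAo hα
  have hsum := sum_abs_coord_le_one hBΦ hBo hy hy1 hαΦ hneg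
  have hexp := sigmaOf_eq_neg hBo hneg
  set c : V → ℝ := fun β => ⟪α, β⟫ / ⟪β, β⟫ with hc
  have hle1 : ∀ β ∈ B, |c β| ≤ 1 := fun β hβ =>
    (Finset.single_le_sum (f := fun β => |c β|) (fun _ _ => abs_nonneg _) hβ).trans hsum
  have hsq : 1 ≤ ∑ β ∈ B, c β ^ 2 := by
    have h1 : ⟪α, α⟫ = ∑ β ∈ B, c β ^ 2 * ⟪β, β⟫ := by
      nth_rewrite 2 [hexp]
      rw [inner_sum]
      refine Finset.sum_congr rfl fun β hβ => ?_
      have := (inner_self_pos (hBΦ β hβ)).ne'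
      rw [real_inner_smul_right, hc]
      field_simp
    have h2 : ⟪α, α⟫ ≤ (∑ β ∈ B, c β ^ 2) * ⟪α, α⟫ := by
      nth_rewrite 1 [h1]
      rw [Finset.sum_mul]
      refine Finset.sum_le_sum fun β hβ => ?_
      by_cases hβA : β ∈ A
      · have : c β = 0 := by
          rw [hc]
          simp [hAo hα hβA fun h => hαB (h ▸ hβ)]
        simp [this]
      · exact mul_le_mul_of_nonneg_left (hmax β hβ hβA) (sq_nonneg _)
    by_contra! hlt
    nlinarith
  have hex : ∃ β ∈ B, |c β| = 1 := by
    by_contra! hcon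
    have hlt : ∀ β ∈ B, |c β| < 1 := fun β hβ => (hle1 β hβ).lt_of_ne (hcon β hβ)
    have h1 : ∑ β ∈ B, (|c β| - c β ^ 2) ≤ 0 := by
      rw [Finset.sum_sub_distrib]
      linarith
    have h2 : ∀ β ∈ B, 0 ≤ |c β| - c β ^ 2 := fun β hβ => by
      rw [← sq_abs]
      nlinarith [abs_nonneg (c β), hlt β hβ]
    have h3 : ∀ β ∈ B, c β = 0 := fun β hβ => by
      have h4 := (Finset.sum_eq_zero_iff_of_nonneg h2).mp
        (le_antisymm h1 (Finset.sum_nonneg h2)) β hβ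
      rw [← sq_abs] at h4
      have h5 : |c β| * (1 - |c β|) = 0 := by linarith
      rcases mul_eq_zero.mp h5 with h6 | h6
      · exact abs_eq_zero.mp h6
      · linarith [hlt β hβ]
    rw [Finset.sum_eq_zero fun β hβ => by rw [h3 β hβ]; ring] at hsq
    linarith
  obtain ⟨β, hβ, hcβ⟩ := hex
  have hother : ∀ γ ∈ B, γ ≠ β → c γ = 0 := fun γ hγ hne => by
    have h1 := Finset.add_sum_erase B (fun β => |c β|) hβ
    have h2 := Finset.single_le_sum (f := fun β => |c β|) (fun _ _ => abs_nonneg _)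
      (Finset.mem_erase.mpr ⟨hne, hγ⟩)
    have h3 : |c γ| ≤ 0 := by
      linarith
    exact abs_nonpos_iff.mp h3
  have hαβ : α = c β • β := by
    nth_rewrite 1 [hexp]
    refine Finset.sum_eq_single β (fun γ hγ hne => ?_) fun h => absurd hβ h
    rw [show ⟪α, γ⟫ / ⟪γ, γ⟫ = 0 from hother γ hγ hne, zero_smul]
  rcases eq_or_eq_neg_of_abs_eq hcβ with h | h
  · rw [h, one_smul] at hαβ
    exact hαB (hαβ ▸ hβ)
  · rw [h, neg_smul, one_smul] at hαβ
    refine not_pos_neg ?_ (hB β hβ)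
    have := hA α hα
    rwa [hαβ, mem_neg_iff, neg_neg] at this

/-- Two orthogonal sets of negative roots, each contained in the roots of value `1` of a minuscule
coweight, coincide if their products of reflections do. -/
lemma eq_of_sigmaOf_eq [FiniteDimensional ℝ V] {A B : Finset V} (hA : ∀ β ∈ A, β ∈ D.Neg) (hB : ∀ β ∈ B, β ∈ D.Neg)
    (hAo : OrthSet A) (hBo : OrthSet B) (hσ : sigmaOf A = sigmaOf B) {x y : V}
    (hx : ∀ α ∈ D.Φ, ⟪x, α⟫ ≤ 1) (hx1 : ∀ β ∈ A, ⟪x, β⟫ = 1)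
    (hy : ∀ α ∈ D.Φ, ⟪y, α⟫ ≤ 1) (hy1 : ∀ β ∈ B, ⟪y, β⟫ = 1) : A = B := by
  by_contra hne
  have hT : (symmDiff A B).Nonempty := by
    rw [Finset.nonempty_iff_ne_empty]
    exact fun h => hne (symmDiff_eq_bot.mp h)
  obtain ⟨α, hα, hmax⟩ := Finset.exists_max_image (symmDiff A B) (fun β => (⟪β, β⟫ : ℝ)) hT
  rcases Finset.mem_symmDiff.mp hα with ⟨h1, h2⟩ | ⟨h1, h2⟩
  · exact h2 (mem_of_maximal_norm hA hB hAo hBo hσ hy hy1 h1 fun β hβ hβ' =>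
      hmax β (Finset.mem_symmDiff.mpr (Or.inr ⟨hβ, hβ'⟩)))
  · exact h2 (mem_of_maximal_norm hB hA hBo hAo hσ.symm hx hx1 h1 fun β hβ hβ' =>
      hmax β (Finset.mem_symmDiff.mpr (Or.inl ⟨hβ, hβ'⟩)))

/-- The Bruhat order on the Weyl group implies the reversed dominance order on the orbit of a
dominant coweight. -/
lemma coweight_le_of_ble [FiniteDimensional ℝ V] {ω : V} (hω : ∀ α ∈ D.Pos, 0 ≤ ⟪ω, α⟫) {x y : V ≃ₗ[ℝ] V}
    (hx : x ∈ D.W) (h : D.ble x y) {γ : V} (hγ : γ ∈ D.Δ) :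
    ⟪D.coweight γ, y ω⟫ ≤ ⟪D.coweight γ, x ω⟫ := by
  refine ble_induction (p := fun y => ⟪D.coweight γ, y ω⟫ ≤ ⟪D.coweight γ, x ω⟫) hx h le_rfl
    fun z hz β hβ hpos ih => ?_
  refine le_trans ?_ ih
  rw [LinearEquiv.mul_apply, sref_apply, inner_sub_right, real_inner_smul_right, W_inner_left hz]
  have h1 := hω _ hpos
  have h2 := inner_self_pos hβ.1
  have h3 := Pos.coweight_nonneg hβ hγ
  have : 0 ≤ 2 * ⟪ω, z⁻¹ β⟫ / ⟪β, β⟫ * ⟪D.coweight γ, β⟫ := by positivity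
  linarith

end RSD

namespace MRSD

open RSD

variable {V}
variable {M : MRSD V}

variable (M) in
/-- The fundamental coweight of the marked simple root. -/
def markedCoweight [FiniteDimensional ℝ V] : V := M.coweight M.αP

lemma markedCoweight_nonneg [FiniteDimensional ℝ V] {α : V} (hα : α ∈ M.Pos) : 0 ≤ ⟪M.markedCoweight, α⟫ :=
  Pos.coweight_nonneg hα M.αP_mem

lemma markedCoweight_le_one [FiniteDimensional ℝ V] {α : V} (hα : α ∈ M.Φ) : ⟪M.markedCoweight, α⟫ ≤ 1 := by
  obtain ⟨c, hc⟩ := M.θ_high α hα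
  obtain ⟨d, hd, hd1⟩ := M.θ_coeff
  have h1 : ⟪M.markedCoweight, M.θ⟫ = 1 := by
    rw [hd, markedCoweight, coweight_inner_sum M.αP_mem fun γ => (d γ : ℝ), hd1, Nat.cast_one]
  have h2 : 0 ≤ ⟪M.markedCoweight, M.θ - α⟫ := by
    rw [hc, markedCoweight, coweight_inner_sum M.αP_mem fun γ => (c γ : ℝ)]
    positivity
  rw [inner_sub_right, h1] at h2
  linarith

lemma markedCoweight_inner_Psi [FiniteDimensional ℝ V] {α : V} (hα : α ∈ M.Psi) : ⟪M.markedCoweight, α⟫ = 1 := by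
  obtain ⟨-, c, rfl, h1⟩ := hα
  rw [markedCoweight, coweight_inner_sum M.αP_mem fun γ => (c γ : ℝ), h1, Nat.cast_one]

lemma WP_markedCoweight [FiniteDimensional ℝ V] {w : V ≃ₗ[ℝ] V} (hw : w ∈ M.WP) :
    w M.markedCoweight = M.markedCoweight := by
  have key : M.WP ≤ MulAction.stabilizer (V ≃ₗ[ℝ] V) M.markedCoweight := by
    rw [WP, Subgroup.closure_le]
    rintro _ ⟨γ, hγ, rfl⟩
    obtain ⟨hne, hγ⟩ := Finset.mem_erase.mp hγ
    refine sref_of_inner_eq_zero ?_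
    rw [markedCoweight, coweight_inner M.αP_mem hγ, if_neg hne.symm]
  exact key hw

lemma IsMinRep.simple_pos [FiniteDimensional ℝ V] {u : V ≃ₗ[ℝ] V} (hu : M.IsMinRep u) {γ : V} (hγ : γ ∈ M.Δ)
    (hne : γ ≠ M.αP) : u γ ∈ M.Pos := by
  refine (pos_or_neg (W_root hu.1 γ (M.Δ_sub hγ))).resolve_right fun hneg => ?_
  have hW := sref_mem_W hγ
  have hlt := length_sref_mul_lt (inv_mem hu.1) (RSD.simple_pos hγ) (by rwa [inv_inv])
  have hle := hu.2 (u * sref V γ) (mul_mem hu.1 hW) (by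
    rw [inv_mul_cancel_left]
    exact Subgroup.subset_closure ⟨γ, Finset.mem_erase.mpr ⟨hne, hγ⟩, rfl⟩)
  rw [← length_inv (mul_mem hu.1 hW), mul_inv_rev, sref_inv, ← length_inv hu.1] at hle
  omega

lemma IsMinRep.pos [FiniteDimensional ℝ V] {u : V ≃ₗ[ℝ] V} (hu : M.IsMinRep u) {α : V} (hα : α ∈ M.Pos)
    (h0 : ⟪M.markedCoweight, α⟫ = 0) : u α ∈ M.Pos := by
  refine pos_of_coweight_nonneg (W_root hu.1 α hα.1) fun δ hδ => ?_
  rw [eq_sum_coweight (D := M.toRSD) α, map_sum, inner_sum]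
  refine Finset.sum_nonneg fun γ hγ => ?_
  rw [map_smul, real_inner_smul_right]
  by_cases hne : γ = M.αP
  · rw [hne, ← markedCoweight, h0, zero_mul]
  · exact mul_nonneg (Pos.coweight_nonneg hα hγ) (Pos.coweight_nonneg (hu.simple_pos hγ hne) hδ)

/-- A minimal coset representative is determined by its action on the marked coweight. -/
lemma IsMinRep.eq_of_apply_eq [FiniteDimensional ℝ V] {u v : V ≃ₗ[ℝ] V} (hu : M.IsMinRep u) (hv : M.IsMinRep v)
    (h : u M.markedCoweight = v M.markedCoweight) : u = v := by
  have hW : u⁻¹ * v ∈ M.W := mul_mem (inv_mem hu.1) hv.1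
  have huw : ∀ α, u ((u⁻¹ * v) α) = v α := fun α => by
    rw [← LinearEquiv.mul_apply, mul_inv_cancel_left]
  have hfix : (u⁻¹ * v) M.markedCoweight = M.markedCoweight := u.injective (by rw [huw, h])
  have hval : ∀ α, ⟪M.markedCoweight, (u⁻¹ * v) α⟫ = ⟪M.markedCoweight, α⟫ := fun α => by
    nth_rewrite 1 [← hfix]
    exact W_inner hW _ _
  refine (inv_mul_eq_one.mp (eq_one_of_map_pos hW fun α hα => ?_))
  have hroot := W_root hW α hα.1
  refine (pos_or_neg hroot).resolve_right fun hneg => ?_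
  have hneg0 := markedCoweight_nonneg hneg
  rw [inner_neg_right, hval] at hneg0
  have h0 : ⟪M.markedCoweight, α⟫ = 0 := le_antisymm (by linarith) (markedCoweight_nonneg hα)
  have h1 := hu.pos hneg (by rw [inner_neg_right, hval, h0, neg_zero])
  rw [map_neg, huw] at h1
  exact not_pos_neg (hv.pos hα h0) h1

lemma exists_isMinRepOf {w : V ≃ₗ[ℝ] V} (hw : w ∈ M.W) : ∃ μ, M.IsMinRepOf μ w := by
  obtain ⟨μ, hμ, hmin⟩ := (measure M.length).wf.has_min
    {u : V ≃ₗ[ℝ] V | u ∈ M.W ∧ w⁻¹ * u ∈ M.WP} ⟨w, hw, by simp [one_mem]⟩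
  exact ⟨μ, hμ, fun u hu hu' => not_lt.mp (hmin u ⟨hu, hu'⟩)⟩

lemma IsMinRepOf.apply_markedCoweight [FiniteDimensional ℝ V] {μ w : V ≃ₗ[ℝ] V} (h : M.IsMinRepOf μ w) :
    μ M.markedCoweight = w M.markedCoweight := by
  have h1 := congrArg w (WP_markedCoweight h.1.2)
  rwa [← LinearEquiv.mul_apply, mul_inv_cancel_left] at h1

section Admissible

variable {v : V ≃ₗ[ℝ] V} {S : Finset V}

lemma Admissible.orthSet_image (h : M.Admissible v S) : OrthSet (S.image fun x => v x) :=
  image_orthSet (W_inner h.1.1) h.2.2.1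

lemma Admissible.neg_image (h : M.Admissible v S) :
    ∀ β ∈ S.image fun x => v x, β ∈ M.Neg := fun β hβ => by
  obtain ⟨γ, hγ, rfl⟩ := Finset.mem_image.mp hβ
  exact h.2.2.2 γ hγ

lemma Admissible.sigmaOf_image_mem_W [FiniteDimensional ℝ V] (h : M.Admissible v S) :
    sigmaOf (S.image fun x => v x) ∈ M.W :=
  sigmaOf_mem_W fun β hβ => Neg.mem (h.neg_image β hβ)

lemma Admissible.le_one [FiniteDimensional ℝ V] (h : M.Admissible v S) :
    ∀ α ∈ M.Φ, ⟪v M.markedCoweight, α⟫ ≤ 1 := fun α hα => by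
  rw [W_inner_left h.1.1]
  exact markedCoweight_le_one (W_root (inv_mem h.1.1) α hα)

lemma Admissible.eq_one [FiniteDimensional ℝ V] (h : M.Admissible v S) :
    ∀ β ∈ S.image fun x => v x, ⟪v M.markedCoweight, β⟫ = 1 := fun β hβ => by
  obtain ⟨γ, hγ, rfl⟩ := Finset.mem_image.mp hβ
  rw [W_inner h.1.1]
  exact markedCoweight_inner_Psi (h.2.1 hγ)

lemma Admissible.traceRank [FiniteDimensional ℝ V] (h : M.Admissible v S) :
    M.traceRank (sigmaOf (S.image fun x => v x)) =
      ((4 * M.pairL v S : ℚ) : ℝ) - Module.finrank ℝ V := by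
  rw [RSD.traceRank, trace_sigmaOf h.orthSet_image fun h0 => ne_zero (Neg.mem (h.neg_image 0 h0)) rfl,
    Finset.card_image_of_injective S v.injective, pairL]
  push_cast
  ring

lemma Admissible.isMinRepOf_apply [FiniteDimensional ℝ V] (h : M.Admissible v S) {μ : V ≃ₗ[ℝ] V}
    (hμ : M.IsMinRepOf μ (v * sigmaOf S)) :
    μ M.markedCoweight = sigmaOf (S.image fun x => v x) (v M.markedCoweight) := by
  rw [hμ.apply_markedCoweight, sigmaOf_image (W_inner h.1.1) h.2.2.1, LinearEquiv.mul_apply]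

lemma Admissible.mul_sigmaOf_mem_W [FiniteDimensional ℝ V] (h : M.Admissible v S) : v * sigmaOf S ∈ M.W :=
  mul_mem h.1.1 (sigmaOf_mem_W fun _ hβ => (h.2.1 hβ).1)

end Admissible

end MRSD

/-- Let `(u,R) ≤ (v,S)` be admissible pairs in the combinatorial order
(`[vσ_S]^P ≤ [uσ_R]^P ≤ u ≤ v` and `σ_{u(R)} ≤ σ_{v(S)}`) with `L(u,R) ≥ L(v,S)`.
Then `(u,R) = (v,S)`. -/
theorem statement19 {V : Type} [NormedAddCommGroup V] [InnerProductSpace ℝ V]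
    [FiniteDimensional ℝ V]
    (M : MRSD V) (u v : V ≃ₗ[ℝ] V) (R S : Finset V)
    (hu : M.Admissible u R) (hv : M.Admissible v S)
    (huv : M.ble u v)
    (hinv : M.ble (sigmaOf (R.image fun x => u x)) (sigmaOf (S.image fun x => v x)))
    (hrep : ∀ μ ν : V ≃ₗ[ℝ] V, M.IsMinRepOf μ (u * sigmaOf R) →
      M.IsMinRepOf ν (v * sigmaOf S) → M.ble ν μ ∧ M.ble μ u)
    (hL : M.pairL v S ≤ M.pairL u R) :
    u = v ∧ R = S := by
  obtain ⟨μ, hμ⟩ := MRSD.exists_isMinRepOf hu.mul_sigmaOf_mem_W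
  obtain ⟨ν, hν⟩ := MRSD.exists_isMinRepOf hv.mul_sigmaOf_mem_W
  have hνμ := (hrep μ ν hμ hν).1
  have hσ : sigmaOf (R.image fun x => u x) = sigmaOf (S.image fun x => v x) := by
    refine RSD.eq_of_ble_of_traceRank_le hu.sigmaOf_image_mem_W hv.sigmaOf_image_mem_W
      (sigmaOf_mul_self hu.orthSet_image) (sigmaOf_mul_self hv.orthSet_image) hinv ?_
    rw [hu.traceRank, hv.traceRank]
    have : ((4 * M.pairL v S : ℚ) : ℝ) ≤ ((4 * M.pairL u R : ℚ) : ℝ) := by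
      exact_mod_cast (by linarith : 4 * M.pairL v S ≤ 4 * M.pairL u R)
    linarith
  have himage := RSD.eq_of_sigmaOf_eq hu.neg_image hv.neg_image hu.orthSet_image hv.orthSet_image
    hσ hu.le_one hu.eq_one hv.le_one hv.eq_one
  have hfix : sigmaOf (S.image fun x => v x) (u M.markedCoweight - v M.markedCoweight) =
      u M.markedCoweight - v M.markedCoweight := by
    refine sigmaOf_of_orthogonal hv.orthSet_image fun β hβ => ?_
    rw [inner_sub_left, hv.eq_one β hβ, hu.eq_one β (himage ▸ hβ), sub_self]
  have heq : u M.markedCoweight = v M.markedCoweight := by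
    refine sub_eq_zero.mp (RSD.eq_zero_of_coweight (D := M.toRSD) fun γ hγ => le_antisymm ?_ ?_)
    · have h1 := RSD.coweight_le_of_ble (fun α => M.markedCoweight_nonneg) hν.1.1 hνμ hγ
      rw [hu.isMinRepOf_apply hμ, hv.isMinRepOf_apply hν, hσ] at h1
      rw [← hfix, map_sub, inner_sub_right]
      linarith
    · have h1 := RSD.coweight_le_of_ble (fun α => M.markedCoweight_nonneg) hu.1.1 huv hγ
      rw [inner_sub_right]
      linarith
  have huv' := hu.1.eq_of_apply_eq hv.1 heq
  refine ⟨huv', ?_⟩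
  rw [huv'] at himage
  exact Finset.image_injective v.injective himage
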